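/- arXiv:1607.04084 — 2 statements merged into one kernel-verified Lean document; each statement's English description precedes it below -/
import Mathlib

section
/- The function n(θ) = 2p(p−1) · ((e^{2θ} − e^θ(θ²+2) + 1)/((e^θ−1)²θ²)) · ((e^θ(θ−1)+1)/((e^θ−1)θ))^{p−2} tends to 0 as θ → −∞ and as θ → +∞. -/
open Real Filter

lemma n_aux (l : Filter ℝ) (p : ℕ) (b : ℝ) (hl : ∀ᶠ θ : ℝ in l, θ ≠ 0)
    (hinv : Tendsto (fun θ : ℝ => θ⁻¹) l (nhds 0))
    (hA : Tendsto (fun θ : ℝ => Real.exp θ / (Real.exp θ - 1) ^ 2) l (nhds 0))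
    (hB : Tendsto (fun θ : ℝ => Real.exp θ / (Real.exp θ - 1)) l (nhds b)) :
    Tendsto (fun θ : ℝ =>
        2 * p * (p - 1) *
          ((Real.exp (2 * θ) - Real.exp θ * (θ ^ 2 + 2) + 1) /
            ((Real.exp θ - 1) ^ 2 * θ ^ 2)) *
          ((Real.exp θ * (θ - 1) + 1) / ((Real.exp θ - 1) * θ)) ^ (p - 2))
      l (nhds 0) := by
  have h := (((hinv.pow 2).sub hA).const_mul (2 * (p : ℝ) * (p - 1))).mul
    ((hB.sub hinv).pow (p - 2))
  have h0 : 2 * (p : ℝ) * (p - 1) * (0 ^ 2 - 0) * (b - 0) ^ (p - 2) = 0 := by simp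
  rw [h0] at h
  refine h.congr' ?_
  filter_upwards [hl] with θ hθ
  have he : Real.exp θ - 1 ≠ 0 := by
    rw [sub_ne_zero]
    simpa using hθ
  have h2 : Real.exp (2 * θ) = Real.exp θ ^ 2 := by
    rw [two_mul, Real.exp_add, sq]
  rw [h2]
  congr 2
  · field_simp
    ring
  · field_simp
    ring

/-- The function
`n(θ) = 2p(p-1) ((e^{2θ}-e^θ(θ²+2)+1)/((e^θ-1)²θ²)) ((e^θ(θ-1)+1)/((e^θ-1)θ))^{p-2}`
tends to 0 as `θ → -∞` and as `θ → +∞`. -/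
theorem n_limit_at_infty (p : ℕ) (hp : 2 ≤ p) :
    Tendsto (fun θ : ℝ =>
        2 * p * (p - 1) *
          ((Real.exp (2 * θ) - Real.exp θ * (θ ^ 2 + 2) + 1) /
            ((Real.exp θ - 1) ^ 2 * θ ^ 2)) *
          ((Real.exp θ * (θ - 1) + 1) / ((Real.exp θ - 1) * θ)) ^ (p - 2))
      atBot (nhds 0) ∧
    Tendsto (fun θ : ℝ =>
        2 * p * (p - 1) *
          ((Real.exp (2 * θ) - Real.exp θ * (θ ^ 2 + 2) + 1) /
            ((Real.exp θ - 1) ^ 2 * θ ^ 2)) *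
          ((Real.exp θ * (θ - 1) + 1) / ((Real.exp θ - 1) * θ)) ^ (p - 2))
      atTop (nhds 0) := by
  constructor
  · have he := Real.tendsto_exp_atBot
    refine n_aux atBot p 0 (eventually_ne_atBot 0) tendsto_inv_atBot_zero ?_ ?_
    · have h := he.div ((he.sub_const 1).pow 2) (by norm_num)
      rw [zero_div] at h
      exact h
    · have h := he.div (he.sub_const 1) (by norm_num)
      rw [zero_div] at h
      exact h
  · have he : Tendsto (fun θ : ℝ => (Real.exp θ)⁻¹) atTop (nhds 0) :=
      Real.tendsto_exp_atTop.inv_tendsto_atTop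
    have h1 : Tendsto (fun θ : ℝ => 1 - (Real.exp θ)⁻¹) atTop (nhds 1) := by
      simpa using he.const_sub 1
    have hev : ∀ θ : ℝ, Real.exp θ - 1 = Real.exp θ * (1 - (Real.exp θ)⁻¹) := by
      intro θ
      rw [mul_sub, mul_inv_cancel₀ (Real.exp_ne_zero θ), mul_one]
    refine n_aux atTop p 1 (eventually_ne_atTop 0) tendsto_inv_atTop_zero ?_ ?_
    · have h := he.div (h1.pow 2) (by norm_num)
      simp only [zero_div] at h
      refine h.congr fun θ => ?_
      simp only [Pi.div_apply]
      rw [hev θ, mul_pow, sq (Real.exp θ), mul_assoc,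
        div_mul_eq_div_div, div_self (Real.exp_ne_zero θ),
        div_mul_eq_div_div, one_div]
    · have h := (tendsto_const_nhds (x := (1 : ℝ))).div h1 (by norm_num)
      simp only [div_one] at h
      refine h.congr fun θ => ?_
      simp only [Pi.div_apply]
      rw [hev θ, div_mul_eq_div_div, div_self (Real.exp_ne_zero θ)]
end

section
/- For the 2-parameter edge-weighted exponential random graph model with uniform(0,1) edge weights, edge term and a subgraph H₂ with p ≥ 2 edges, in the region β₂ ≥ 0 the limiting normalization constant equals ψ_∞^β = sup_{0≤u≤1} (β₁u + β₂u^p − (1/2)I(u)), where I is the Cramér rate function of the uniform(0,1) distribution; moreover, if for p = 2 one takes β₂ = −β₁, then l(u) = β₁(u − u²) − (1/2)I(u) satisfies l(u) = l(1−u) for all u ∈ (0,1). -/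
open MeasureTheory Real Filter

/-- Uniform distribution on `(0,1)`. -/
noncomputable def unifMeasure : Measure ℝ := volume.restrict (Set.Ioo (0:ℝ) 1)

/-- iid uniform edge weights: product measure on ordered pairs. -/
noncomputable def weightMeasure (n : ℕ) : Measure (Fin n → Fin n → ℝ) :=
  Measure.pi fun _ => Measure.pi fun _ => unifMeasure

/-- Symmetrized edge weight between vertices `i` and `j`. -/
noncomputable def symWeight {n : ℕ} (w : Fin n → Fin n → ℝ) (i j : Fin n) : ℝ :=
  if i ≤ j then w i j else w j i

/-- Edge homomorphism density of the weighted graph. -/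
noncomputable def edgeDensity {n : ℕ} (w : Fin n → Fin n → ℝ) : ℝ :=
  (1 / (n : ℝ) ^ 2) * ∑ i : Fin n, ∑ j : Fin n, symWeight w i j

/-- Homomorphism density of a finite simple graph `H` in the weighted graph on `n`
vertices with (symmetrized) weights `w`. -/
noncomputable def homDensity {k n : ℕ} (H : SimpleGraph (Fin k)) [DecidableRel H.Adj]
    (w : Fin n → Fin n → ℝ) : ℝ :=
  (1 / (n : ℝ) ^ k) * ∑ φ : Fin k → Fin n,
    ∏ q ∈ Finset.univ.filter (fun q : Fin k × Fin k => H.Adj q.1 q.2 ∧ q.1 < q.2),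
      symWeight w (φ q.1) (φ q.2)

/-- Normalization constant of the 2-parameter edge-weighted exponential random graph
model with uniform(0,1) edge weights, edge term and subgraph term `H`. -/
noncomputable def psiERGM {k : ℕ} (H : SimpleGraph (Fin k)) [DecidableRel H.Adj]
    (β₁ β₂ : ℝ) (n : ℕ) : ℝ :=
  (1 / (n : ℝ) ^ 2) * Real.log (∫ w, Real.exp ((n : ℝ) ^ 2 *
    (β₁ * edgeDensity w + β₂ * homDensity H w)) ∂(weightMeasure n))

/-! ### One-dimensional facts -/

lemma unif_integrable {f : ℝ → ℝ} (hf : Continuous f) : Integrable f unifMeasure := by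
  have : IntegrableOn f (Set.Icc (0:ℝ) 1) volume := hf.integrableOn_Icc
  exact this.mono_set Set.Ioo_subset_Icc_self

instance unif_prob : IsProbabilityMeasure unifMeasure := by
  constructor
  simp [unifMeasure]

lemma unif_ae : ∀ᵐ x ∂unifMeasure, x ∈ Set.Icc (0:ℝ) 1 := by
  have := ae_restrict_mem (μ := volume) (measurableSet_Ioo (a := (0:ℝ)) (b := 1))
  filter_upwards [this] with x hx using ⟨hx.1.le, hx.2.le⟩

noncomputable def Mu (θ : ℝ) : ℝ := ∫ x, Real.exp (θ * x) ∂unifMeasure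

lemma Mu_eq (θ : ℝ) : Mu θ = if θ = 0 then 1 else (Real.exp θ - 1) / θ := by
  split_ifs with h
  · simp [Mu, h]
  · unfold Mu unifMeasure
    rw [← integral_Ioc_eq_integral_Ioo, ← intervalIntegral.integral_of_le zero_le_one]
    rw [intervalIntegral.integral_comp_mul_left (fun x => Real.exp x) h]
    simp
    field_simp

lemma Mu_pos (θ : ℝ) : 0 < Mu θ := by
  exact integral_exp_pos (unif_integrable (by fun_prop))

noncomputable def Lam (θ : ℝ) : ℝ := Real.log (Mu θ)

lemma Mu_zero : Mu 0 = 1 := by simp [Mu_eq]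
lemma Lam_zero : Lam 0 = 0 := by simp [Lam, Mu_zero]

lemma tilt_one (θ : ℝ) : ∫ x, Real.exp (θ * x - Lam θ) ∂unifMeasure = 1 := by
  have : ∀ x, Real.exp (θ * x - Lam θ) = Real.exp (θ * x) / Mu θ := by
    intro x
    rw [Real.exp_sub, Lam, Real.exp_log (Mu_pos θ)]
  simp_rw [this]
  rw [integral_div]
  exact div_self (Mu_pos θ).ne'

noncomputable def um (θ : ℝ) : ℝ := ∫ x, x * Real.exp (θ * x - Lam θ) ∂unifMeasure

lemma um_nonneg (θ : ℝ) : 0 ≤ um θ := by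
  apply integral_nonneg_of_ae
  filter_upwards [unif_ae] with x hx
  exact mul_nonneg hx.1 (Real.exp_pos _).le

lemma um_le_one (θ : ℝ) : um θ ≤ 1 := by
  rw [← tilt_one θ]
  apply integral_mono_ae (unif_integrable (by fun_prop)) (unif_integrable (by fun_prop))
  filter_upwards [unif_ae] with x hx
  exact mul_le_of_le_one_left (Real.exp_pos _).le hx.2

/-- tangent line inequality -/
lemma Lam_tangent (θ η : ℝ) : Lam θ + (η - θ) * um θ ≤ Lam η := by
  rw [Lam, Lam, Real.le_log_iff_exp_le (Mu_pos η)]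
  set c := (η - θ) * um θ with hc
  have key : ∫ x, (Real.exp (Lam θ + c) * ((1 - c) * Real.exp (θ * x - Lam θ)
      + (η - θ) * (x * Real.exp (θ * x - Lam θ)))) ∂unifMeasure ≤ Mu η := by
    unfold Mu
    apply integral_mono (unif_integrable (by fun_prop)) (unif_integrable (by fun_prop))
    intro x
    have h1 := Real.add_one_le_exp ((η - θ) * x - c)
    have h2 : Real.exp (η * x) = Real.exp (Lam θ + c) * (Real.exp (θ * x - Lam θ) *
        Real.exp ((η - θ) * x - c)) := by
      rw [← Real.exp_add, ← Real.exp_add]; congr 1; ring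
    show _ ≤ Real.exp (η * x)
    rw [h2]
    apply mul_le_mul_of_nonneg_left _ (Real.exp_pos _).le
    have := mul_le_mul_of_nonneg_left h1 (Real.exp_pos (θ * x - Lam θ)).le
    linarith
  rw [integral_const_mul, integral_add (unif_integrable (by fun_prop))
    (unif_integrable (by fun_prop)), integral_const_mul, integral_const_mul, tilt_one] at key
  change _ * (_ + (η - θ) * um θ) ≤ _ at key
  rw [← hc] at key
  simpa [Lam] using key

lemma Lam_double (b : ℝ) : 2 * Lam b ≤ Lam (2 * b) := by
  have h1 := Lam_tangent b (2 * b)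
  have h2 := Lam_tangent b 0
  rw [Lam_zero] at h2
  linarith

lemma Lam_le_abs (b : ℝ) : Lam b ≤ |b| := by
  have h2 := Lam_tangent b 0
  rw [Lam_zero] at h2
  have : b * um b ≤ |b| := by
    calc b * um b ≤ |b| * um b := mul_le_mul_of_nonneg_right (le_abs_self b) (um_nonneg b)
      _ ≤ |b| * 1 := mul_le_mul_of_nonneg_left (um_le_one b) (abs_nonneg b)
      _ = |b| := mul_one _
  linarith

lemma Lam_neg (θ : ℝ) : Lam (-θ) = Lam θ - θ := by
  have h : Mu (-θ) = Mu θ * Real.exp (-θ) := by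
    rw [Mu_eq, Mu_eq]
    by_cases h : θ = 0
    · simp [h]
    · simp only [neg_eq_zero, h, if_false]
      rw [Real.exp_neg]
      have := (Real.exp_pos θ).ne'
      field_simp
      ring
  rw [Lam, h, Real.log_mul (Mu_pos θ).ne' (Real.exp_pos _).ne', Real.log_exp, Lam]
  ring

/-! ### Product measure -/

instance weight_prob (n : ℕ) : IsProbabilityMeasure (weightMeasure n) := by
  unfold weightMeasure; infer_instance

lemma weight_ae (n : ℕ) : ∀ᵐ w ∂(weightMeasure n), ∀ i j, w i j ∈ Set.Icc (0:ℝ) 1 := by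
  rw [ae_all_iff]; intro i
  rw [ae_all_iff]; intro j
  have h1 := (measurePreserving_eval (fun _ : Fin n => Measure.pi fun _ : Fin n => unifMeasure) i)
  have h2 := (measurePreserving_eval (fun _ : Fin n => unifMeasure) j)
  exact (h2.comp h1).quasiMeasurePreserving.ae unif_ae

lemma weight_integrable {n : ℕ} {f : (Fin n → Fin n → ℝ) → ℝ} (hf : Continuous f) :
    Integrable f (weightMeasure n) := by
  have hK : IsCompact (Set.Icc (0 : Fin n → Fin n → ℝ) 1) := isCompact_Icc
  have h := hf.continuousOn.integrableOn_compact (μ := weightMeasure n) hK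
  have h2 : (weightMeasure n).restrict (Set.Icc (0 : Fin n → Fin n → ℝ) 1) = weightMeasure n := by
    apply Measure.restrict_eq_self_of_ae_mem
    filter_upwards [weight_ae n] with w hw
    exact ⟨fun i j => (hw i j).1, fun i j => (hw i j).2⟩
  rwa [IntegrableOn, h2] at h

lemma weight_integral_prod {n : ℕ} (f : Fin n → Fin n → ℝ → ℝ) :
    ∫ w, (∏ i, ∏ j, f i j (w i j)) ∂(weightMeasure n) = ∏ i, ∏ j, ∫ x, f i j x ∂unifMeasure := by
  unfold weightMeasure
  rw [integral_fintype_prod_eq_prod (f := fun (i : Fin n) (v : Fin n → ℝ) => ∏ j, f i j (v j))]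
  refine Finset.prod_congr rfl fun i _ => ?_
  rw [integral_fintype_prod_eq_prod (f := fun (j : Fin n) (x : ℝ) => f i j x)]

/-! ### Block averages and weak regularity -/

/-- number of vertices in the class of `i` -/
noncomputable def clsN {n : ℕ} (P : Fin n → ℕ) (c : ℕ) : ℝ := ∑ i, if P i = c then (1:ℝ) else 0

noncomputable def blkSum {n : ℕ} (P : Fin n → ℕ) (x : Fin n → Fin n → ℝ) (c d : ℕ) : ℝ :=
  ∑ i, ∑ j, (if P i = c then (1:ℝ) else 0) * (if P j = d then (1:ℝ) else 0) * x i j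

noncomputable def blkAvg {n : ℕ} (P : Fin n → ℕ) (x : Fin n → Fin n → ℝ) (c d : ℕ) : ℝ :=
  blkSum P x c d / (clsN P c * clsN P d)

lemma clsN_pos {n : ℕ} (P : Fin n → ℕ) (i : Fin n) : 0 < clsN P (P i) := by
  unfold clsN
  apply Finset.sum_pos' 
  · intro j _; split_ifs <;> norm_num
  · exact ⟨i, Finset.mem_univ _, by simp⟩

lemma clsN_nonneg {n : ℕ} (P : Fin n → ℕ) (c : ℕ) : 0 ≤ clsN P c := by
  unfold clsN
  apply Finset.sum_nonneg
  intro j _; split_ifs <;> norm_num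

lemma blkAvg_nonneg {n : ℕ} (P : Fin n → ℕ) (x : Fin n → Fin n → ℝ) (hx : ∀ i j, 0 ≤ x i j)
    (c d : ℕ) : 0 ≤ blkAvg P x c d := by
  unfold blkAvg blkSum
  apply div_nonneg
  · refine Finset.sum_nonneg fun i _ => Finset.sum_nonneg fun j _ => ?_
    have := hx i j
    split_ifs <;> simp [this]
  · exact mul_nonneg (clsN_nonneg _ _) (clsN_nonneg _ _)

lemma blkAvg_le_one {n : ℕ} (P : Fin n → ℕ) (x : Fin n → Fin n → ℝ) (hx : ∀ i j, x i j ≤ 1)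
    (c d : ℕ) : blkAvg P x c d ≤ 1 := by
  unfold blkAvg blkSum
  apply div_le_one_of_le₀
  · unfold clsN
    rw [Finset.sum_mul_sum]
    refine Finset.sum_le_sum fun i _ => Finset.sum_le_sum fun j _ => ?_
    have := hx i j
    split_ifs <;> simp [this]
  · exact mul_nonneg (clsN_nonneg _ _) (clsN_nonneg _ _)

lemma blkAvg_symm {n : ℕ} (P : Fin n → ℕ) (x : Fin n → Fin n → ℝ) (hx : ∀ i j, x i j = x j i)
    (c d : ℕ) : blkAvg P x c d = blkAvg P x d c := by
  unfold blkAvg blkSum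
  rw [Finset.sum_comm, mul_comm (clsN P c)]
  congr 1
  refine Finset.sum_congr rfl fun i _ => Finset.sum_congr rfl fun j _ => ?_
  rw [hx j i]; ring

lemma blk_proj {n : ℕ} (P : Fin n → ℕ) (x g : Fin n → Fin n → ℝ)
    (hg : ∀ i i' j j', P i = P i' → P j = P j' → g i j = g i' j') :
    ∑ i, ∑ j, g i j * blkAvg P x (P i) (P j) = ∑ i, ∑ j, g i j * x i j := by
  have e1 : ∀ i j, g i j * blkAvg P x (P i) (P j) = ∑ i', ∑ j',
      (if P i' = P i then (1:ℝ) else 0) * (if P j' = P j then (1:ℝ) else 0) *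
        (g i' j' * x i' j' / (clsN P (P i') * clsN P (P j'))) := by
    intro i j
    unfold blkAvg blkSum
    rw [Finset.sum_div, Finset.mul_sum]
    refine Finset.sum_congr rfl fun i' _ => ?_
    rw [Finset.sum_div, Finset.mul_sum]
    refine Finset.sum_congr rfl fun j' _ => ?_
    by_cases h1 : P i' = P i
    · by_cases h2 : P j' = P j
      · rw [hg i i' j j' h1.symm h2.symm, h1, h2]; simp; ring
      · simp [h2]
    · simp [h1]
  simp_rw [e1]
  have e2 : ∀ (F : Fin n → Fin n → Fin n → Fin n → ℝ), ∑ i, ∑ j, ∑ i', ∑ j', F i j i' j' =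
      ∑ i', ∑ j', ∑ i, ∑ j, F i j i' j' := by
    intro F
    calc ∑ i, ∑ j, ∑ i', ∑ j', F i j i' j' = ∑ i, ∑ i', ∑ j, ∑ j', F i j i' j' := by
          refine Finset.sum_congr rfl fun i _ => ?_; rw [Finset.sum_comm]
      _ = ∑ i', ∑ i, ∑ j, ∑ j', F i j i' j' := Finset.sum_comm
      _ = ∑ i', ∑ i, ∑ j', ∑ j, F i j i' j' := by
          refine Finset.sum_congr rfl fun i _ => Finset.sum_congr rfl fun i _ => ?_
          rw [Finset.sum_comm]
      _ = _ := by
          refine Finset.sum_congr rfl fun i _ => ?_; rw [Finset.sum_comm]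
  rw [e2]
  refine Finset.sum_congr rfl fun i' _ => Finset.sum_congr rfl fun j' _ => ?_
  simp_rw [← Finset.sum_mul]
  rw [← Finset.sum_mul_sum]
  have h3 : ∀ i : Fin n, (∑ i', if P i = P i' then (1:ℝ) else 0) = clsN P (P i) := by
    intro i; unfold clsN
    refine Finset.sum_congr rfl fun i' _ => ?_
    simp only [eq_comm]
  rw [h3, h3]
  have := clsN_pos P i'
  have := clsN_pos P j'
  field_simp

noncomputable def energy {n : ℕ} (P : Fin n → ℕ) (x : Fin n → Fin n → ℝ) : ℝ :=
  ∑ i, ∑ j, blkAvg P x (P i) (P j) ^ 2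

lemma energy_incr {n : ℕ} (P P' : Fin n → ℕ) (x : Fin n → Fin n → ℝ)
    (hP : ∀ i i', P' i = P' i' → P i = P i') :
    ∑ i, ∑ j, (blkAvg P' x (P' i) (P' j) - blkAvg P x (P i) (P j)) ^ 2 =
      energy P' x - energy P x := by
  have h1 := blk_proj P' x (fun i j => blkAvg P x (P i) (P j)) (by
    intro i i' j j' hi hj; simp only [hP _ _ hi, hP _ _ hj])
  have h2 := blk_proj P x (fun i j => blkAvg P x (P i) (P j)) (by
    intro i i' j j' hi hj; simp only [hi, hj])
  have h3 : ∑ i, ∑ j, (blkAvg P' x (P' i) (P' j) - blkAvg P x (P i) (P j)) ^ 2 =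
      energy P' x + ∑ i, ∑ j, blkAvg P x (P i) (P j) * blkAvg P x (P i) (P j)
        - 2 * ∑ i, ∑ j, blkAvg P x (P i) (P j) * blkAvg P' x (P' i) (P' j) := by
    unfold energy
    simp only [Finset.mul_sum, ← Finset.sum_add_distrib, ← Finset.sum_sub_distrib]
    refine Finset.sum_congr rfl fun i _ => Finset.sum_congr rfl fun j _ => ?_
    ring
  have h4 : energy P x = ∑ i, ∑ j, blkAvg P x (P i) (P j) * blkAvg P x (P i) (P j) := by
    unfold energy; simp only [sq]
  rw [h3, h1, ← h2, h4]; ring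

lemma energy_step {n : ℕ} (P : Fin n → ℕ) (x : Fin n → Fin n → ℝ) (ε : ℝ) (hε : 0 < ε)
    (m : ℕ) (hPm : ∀ i, P i < 4 ^ m) (S T : Finset (Fin n))
    (hST : ε * (n:ℝ) ^ 2 < ∑ i ∈ S, ∑ j ∈ T, (x i j - blkAvg P x (P i) (P j))) :
    ∃ P' : Fin n → ℕ, (∀ i, P' i < 4 ^ (m + 1)) ∧ 
      energy P x + ε ^ 2 * (n:ℝ) ^ 2 ≤ energy P' x := by
  classical
  let P' : Fin n → ℕ := fun i => 4 * P i + 2 * (if i ∈ S then 1 else 0) + (if i ∈ T then 1 else 0)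
  have hP1 : ∀ i i', P' i = P' i' → P i = P i' := by
    intro i i' h; simp only [P'] at h; split_ifs at h <;> omega
  have hP2 : ∀ i i', P' i = P' i' → (i ∈ S ↔ i' ∈ S) := by
    intro i i' h; simp only [P'] at h; split_ifs at h <;> simp_all <;> omega
  have hP3 : ∀ i i', P' i = P' i' → (i ∈ T ↔ i' ∈ T) := by
    intro i i' h; simp only [P'] at h; split_ifs at h <;> simp_all <;> omega
  refine ⟨P', ?_, ?_⟩
  · intro i
    have := hPm i
    simp only [P', pow_succ]
    split_ifs <;> omega
  · have hinc := energy_incr P P' x hP1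
    let g : Fin n → Fin n → ℝ := fun i j => (if i ∈ S then 1 else 0) * (if j ∈ T then 1 else 0)
    have hproj := blk_proj P' x g (by
      intro i i' j j' hi hj
      simp only [g, hP2 _ _ hi, hP3 _ _ hj])
    have hsum : ∑ i ∈ S, ∑ j ∈ T, (x i j - blkAvg P x (P i) (P j)) =
        ∑ i, ∑ j, g i j * (blkAvg P' x (P' i) (P' j) - blkAvg P x (P i) (P j)) := by
      have gF : ∀ F : Fin n → Fin n → ℝ, ∑ i ∈ S, ∑ j ∈ T, F i j = ∑ i, ∑ j, g i j * F i j := by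
        intro F
        simp only [g, mul_assoc, ← Finset.mul_sum]
        simp only [ite_mul, one_mul, zero_mul, Finset.sum_ite_mem, Finset.univ_inter]
      rw [gF]
      simp only [mul_sub, Finset.sum_sub_distrib, hproj]
    rw [hsum] at hST
    have hcs : (∑ i, ∑ j, g i j * (blkAvg P' x (P' i) (P' j) - blkAvg P x (P i) (P j))) ^ 2 ≤
        (∑ i, ∑ j, g i j ^ 2) *
        (∑ i, ∑ j, (blkAvg P' x (P' i) (P' j) - blkAvg P x (P i) (P j)) ^ 2) := by
      simp only [← Finset.sum_product']
      exact Finset.sum_mul_sq_le_sq_mul_sq _ _ _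
    have hg : ∑ i, ∑ j, g i j ^ 2 ≤ (n:ℝ) ^ 2 := by
      calc ∑ i, ∑ j, g i j ^ 2 ≤ ∑ i : Fin n, ∑ j : Fin n, (1:ℝ) := by
            refine Finset.sum_le_sum fun i _ => Finset.sum_le_sum fun j _ => ?_
            simp only [g]; split_ifs <;> norm_num
        _ = (n:ℝ) ^ 2 := by simp [sq]
    rw [hinc] at hcs
    have hd : 0 ≤ energy P' x - energy P x := by
      rw [← hinc]
      exact Finset.sum_nonneg fun i _ => Finset.sum_nonneg fun j _ => sq_nonneg _
    have h5 : (ε * (n:ℝ) ^ 2) ^ 2 < (n:ℝ) ^ 2 * (energy P' x - energy P x) := by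
      calc (ε * (n:ℝ) ^ 2) ^ 2 < _ := pow_lt_pow_left₀ hST (by positivity) (by norm_num)
        _ ≤ _ := hcs
        _ ≤ _ := mul_le_mul_of_nonneg_right hg hd
    by_cases hn : (n:ℝ) = 0
    · rw [hn] at h5; simp at h5
    · have hn2 : 0 < (n:ℝ) ^ 2 := by positivity
      have : (n:ℝ) ^ 2 * (ε ^ 2 * (n:ℝ) ^ 2) < (n:ℝ) ^ 2 * (energy P' x - energy P x) := by
        calc _ = (ε * (n:ℝ) ^ 2) ^ 2 := by ring
          _ < _ := h5
      have := lt_of_mul_lt_mul_left this hn2.le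
      linarith

/-- one-sided weak regularity lemma -/
lemma weak_regularity (ε : ℝ) (hε : 0 < ε) : ∃ K : ℕ, ∀ (n : ℕ) (x : Fin n → Fin n → ℝ),
    (∀ i j, 0 ≤ x i j) → (∀ i j, x i j ≤ 1) → ∃ P : Fin n → ℕ, (∀ i, P i < K) ∧
      ∀ S T : Finset (Fin n), ∑ i ∈ S, ∑ j ∈ T, (x i j - blkAvg P x (P i) (P j)) ≤
        ε * (n:ℝ) ^ 2 := by
  obtain ⟨m, hm⟩ := exists_nat_gt (1 / ε ^ 2)
  refine ⟨4 ^ m, fun n x h0 h1 => ?_⟩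
  by_contra! hcon
  have hind : ∀ l ≤ m, ∃ P : Fin n → ℕ, (∀ i, P i < 4 ^ l) ∧ l * (ε ^ 2 * (n:ℝ) ^ 2) ≤ energy P x := by
    intro l
    induction l with
    | zero =>
      intro _
      refine ⟨fun _ => 0, by simp, ?_⟩
      simp only [Nat.cast_zero, zero_mul]
      exact Finset.sum_nonneg fun i _ => Finset.sum_nonneg fun j _ => sq_nonneg _
    | succ l ih =>
      intro hl
      obtain ⟨P, hP, hE⟩ := ih (by omega)
      obtain ⟨S, T, hST⟩ := hcon P (fun i => (hP i).trans_le (Nat.pow_le_pow_right (by norm_num) (by omega)))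
      obtain ⟨P', hP', hE'⟩ := energy_step P x ε hε l hP S T hST
      refine ⟨P', hP', ?_⟩
      push_cast
      linarith
  obtain ⟨P, hP, hE⟩ := hind m le_rfl
  have hle : energy P x ≤ (n:ℝ) ^ 2 := by
    calc energy P x ≤ ∑ i : Fin n, ∑ j : Fin n, (1:ℝ) := by
          refine Finset.sum_le_sum fun i _ => Finset.sum_le_sum fun j _ => ?_
          exact pow_le_one₀ (blkAvg_nonneg P x h0 _ _) (blkAvg_le_one P x h1 _ _)
      _ = (n:ℝ) ^ 2 := by simp [sq]
  rw [div_lt_iff₀ (by positivity)] at hm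
  have hn : 0 < n := by
    rcases Nat.eq_zero_or_pos n with h | h
    · subst h
      obtain ⟨S, T, hST⟩ := hcon (fun _ => 0) (fun i => i.elim0)
      have : S = ∅ := by ext i; exact i.elim0
      simp [this] at hST
    · exact h
  have hn2 : 0 < (n:ℝ) ^ 2 := by positivity
  nlinarith

lemma cut_fun {n : ℕ} (D : Fin n → Fin n → ℝ) (c : ℝ)
    (hD : ∀ S T : Finset (Fin n), ∑ i ∈ S, ∑ j ∈ T, D i j ≤ c) (f g : Fin n → ℝ)
    (hf0 : ∀ i, 0 ≤ f i) (hf1 : ∀ i, f i ≤ 1) (hg0 : ∀ i, 0 ≤ g i) (hg1 : ∀ i, g i ≤ 1) :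
    ∑ i, ∑ j, D i j * (f i * g j) ≤ c := by
  classical
  have gen : ∀ (v f : Fin n → ℝ), (∀ i, 0 ≤ f i) → (∀ i, f i ≤ 1) →
      ∑ i, f i * v i ≤ ∑ i ∈ Finset.univ.filter (fun i => 0 < v i), v i := by
    intro v f h0 h1
    rw [Finset.sum_filter]
    refine Finset.sum_le_sum fun i _ => ?_
    split_ifs with h
    · exact mul_le_of_le_one_left h.le (h1 i)
    · exact mul_nonpos_of_nonneg_of_nonpos (h0 i) (not_lt.mp h)
  calc ∑ i, ∑ j, D i j * (f i * g j) = ∑ i, f i * ∑ j, D i j * g j := by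
        simp only [Finset.mul_sum]
        refine Finset.sum_congr rfl fun i _ => Finset.sum_congr rfl fun j _ => by ring
    _ ≤ ∑ i ∈ Finset.univ.filter (fun i => 0 < ∑ j, D i j * g j), ∑ j, D i j * g j :=
        gen _ _ hf0 hf1
    _ = ∑ j, g j * ∑ i ∈ Finset.univ.filter (fun i => 0 < ∑ j, D i j * g j), D i j := by
        rw [Finset.sum_comm]
        simp only [Finset.mul_sum]
        refine Finset.sum_congr rfl fun i _ => Finset.sum_congr rfl fun j _ => by ring
    _ ≤ _ := gen _ _ hg0 hg1
    _ = _ := Finset.sum_comm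
    _ ≤ c := hD _ _

/-! ### Counting lemma -/

lemma sum_update {k n : ℕ} (a : Fin k) (G : (Fin k → Fin n) → ℝ) :
    ∑ φ : Fin k → Fin n, ∑ i : Fin n, G (Function.update φ a i) = n * ∑ φ, G φ := by
  rw [← Fintype.sum_prod_type']
  have : ∑ z : (Fin k → Fin n) × Fin n, G (Function.update z.1 a z.2) =
      ∑ z : (Fin k → Fin n) × Fin n, G z.1 := by
    apply Fintype.sum_equiv (Function.Involutive.toPerm
      (fun z : (Fin k → Fin n) × Fin n => (Function.update z.1 a z.2, z.1 a))
      (by intro z; simp))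
    intro z
    simp [Function.Involutive.toPerm]
  rw [this, Fintype.sum_prod_type]
  simp [Finset.mul_sum]

lemma sum_update2 {k n : ℕ} (a b : Fin k) (G : (Fin k → Fin n) → ℝ) :
    ∑ φ : Fin k → Fin n, ∑ i : Fin n, ∑ j : Fin n,
      G (Function.update (Function.update φ a i) b j) = (n:ℝ) ^ 2 * ∑ φ, G φ := by
  have := sum_update a (fun φ : Fin k → Fin n => ∑ j, G (Function.update φ b j))
  rw [this, sum_update]; ring

lemma count_step {k n : ℕ} (D : Fin n → Fin n → ℝ) (c : ℝ)
    (hD : ∀ S T : Finset (Fin n), ∑ i ∈ S, ∑ j ∈ T, D i j ≤ c * (n:ℝ) ^ 2)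
    (E : Finset (Fin k × Fin k)) (hE : ∀ q ∈ E, q.1 < q.2) (e : Fin k × Fin k) (he : e.1 < e.2)
    (heE : e ∉ E) (y : Fin k × Fin k → Fin n → Fin n → ℝ)
    (h0 : ∀ q i j, 0 ≤ y q i j) (h1 : ∀ q i j, y q i j ≤ 1) :
    ∑ φ : Fin k → Fin n, D (φ e.1) (φ e.2) * ∏ q ∈ E, y q (φ q.1) (φ q.2) ≤ c * (n:ℝ) ^ k := by
  classical
  obtain ⟨a, b⟩ := e
  simp only at he ⊢
  rcases Nat.eq_zero_or_pos n with hn | hn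
  · subst hn
    have hk : k ≠ 0 := by rintro rfl; exact a.elim0
    have : Nonempty (Fin k) := ⟨a⟩
    have : IsEmpty (Fin k → Fin 0) := ⟨fun f => (f a).elim0⟩
    simp [hk]
  have hn2 : 0 < (n:ℝ) ^ 2 := by positivity
  refine le_of_mul_le_mul_left ?_ hn2
  rw [← sum_update2 a b]
  calc _ ≤ ∑ φ : Fin k → Fin n, c * (n:ℝ) ^ 2 := ?_
    _ = _ := by simp; ring
  refine Finset.sum_le_sum fun φ _ => ?_
  let f : Fin n → ℝ := fun i => ∏ q ∈ E with ¬(q.1 = b ∨ q.2 = b),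
    y q (Function.update φ a i q.1) (Function.update φ a i q.2)
  let g : Fin n → ℝ := fun j => ∏ q ∈ E with (q.1 = b ∨ q.2 = b),
    y q (Function.update φ b j q.1) (Function.update φ b j q.2)
  have hfg : ∀ i j, ∏ q ∈ E, y q (Function.update (Function.update φ a i) b j q.1)
      (Function.update (Function.update φ a i) b j q.2) = f i * g j := by
    intro i j
    rw [← Finset.prod_filter_mul_prod_filter_not E (fun q => q.1 = b ∨ q.2 = b), mul_comm]
    congr 1
    · refine Finset.prod_congr rfl fun q hq => ?_
      simp only [Finset.mem_filter, not_or] at hq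
      rw [Function.update_of_ne hq.2.1, Function.update_of_ne hq.2.2]
    · refine Finset.prod_congr rfl fun q hq => ?_
      simp only [Finset.mem_filter] at hq
      have hlt := hE q hq.1
      have hna : q.1 ≠ a ∧ q.2 ≠ a := by
        constructor
        · rintro rfl
          rcases hq.2 with h | h
          · exact he.ne h
          · apply heE; rw [← h]; exact hq.1
        · rintro rfl
          rcases hq.2 with h | h
          · rw [h] at hlt; exact lt_asymm he hlt
          · exact he.ne h
      rw [Function.update_comm he.ne, Function.update_of_ne hna.1, Function.update_of_ne hna.2]
  have := cut_fun D _ hD f g (fun i => Finset.prod_nonneg fun q _ => h0 _ _ _)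
    (fun i => Finset.prod_le_one (fun q _ => h0 _ _ _) (fun q _ => h1 _ _ _))
    (fun i => Finset.prod_nonneg fun q _ => h0 _ _ _)
    (fun i => Finset.prod_le_one (fun q _ => h0 _ _ _) (fun q _ => h1 _ _ _))
  refine le_trans (le_of_eq ?_) this
  refine Finset.sum_congr rfl fun i _ => Finset.sum_congr rfl fun j _ => ?_
  rw [hfg, Function.update_of_ne he.ne, Function.update_self, Function.update_self]

lemma counting {k n : ℕ} (x z : Fin n → Fin n → ℝ) (c : ℝ)
    (hD : ∀ S T : Finset (Fin n), ∑ i ∈ S, ∑ j ∈ T, (x i j - z i j) ≤ c * (n:ℝ) ^ 2)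
    (hx0 : ∀ i j, 0 ≤ x i j) (hx1 : ∀ i j, x i j ≤ 1)
    (hz0 : ∀ i j, 0 ≤ z i j) (hz1 : ∀ i j, z i j ≤ 1)
    (E : Finset (Fin k × Fin k)) (hE : ∀ q ∈ E, q.1 < q.2) :
    ∑ φ : Fin k → Fin n, ∏ q ∈ E, x (φ q.1) (φ q.2) ≤
      ∑ φ : Fin k → Fin n, ∏ q ∈ E, z (φ q.1) (φ q.2) + E.card * (c * (n:ℝ) ^ k) := by
  classical
  have main : ∀ A : Finset (Fin k × Fin k), A ⊆ E →
      ∑ φ : Fin k → Fin n, ∏ q ∈ E, x (φ q.1) (φ q.2) ≤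
      ∑ φ : Fin k → Fin n, ∏ q ∈ E, (if q ∈ A then z else x) (φ q.1) (φ q.2)
        + A.card * (c * (n:ℝ) ^ k) := by
    intro A
    induction A using Finset.induction_on with
    | empty => intro _; simp
    | insert e A heA ih =>
      intro hA
      have heE : e ∈ E := hA (Finset.mem_insert_self _ _)
      have ih' := ih ((Finset.subset_insert _ _).trans hA)
      have st := count_step (fun i j => x i j - z i j) c hD (E.erase e)
        (fun q hq => hE q (Finset.mem_of_mem_erase hq)) e (hE e heE) (Finset.notMem_erase e E)
        (fun q => if q ∈ A then z else x)
        (by intro q i j; split_ifs; exacts [hz0 i j, hx0 i j])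
        (by intro q i j; split_ifs; exacts [hz1 i j, hx1 i j])
      have e1 : ∀ φ : Fin k → Fin n, ∏ q ∈ E, (if q ∈ A then z else x) (φ q.1) (φ q.2) =
          x (φ e.1) (φ e.2) * ∏ q ∈ E.erase e, (if q ∈ A then z else x) (φ q.1) (φ q.2) := by
        intro φ
        rw [← Finset.mul_prod_erase E _ heE]; simp [heA]
      have e2 : ∀ φ : Fin k → Fin n, ∏ q ∈ E, (if q ∈ insert e A then z else x) (φ q.1) (φ q.2) =
          z (φ e.1) (φ e.2) * ∏ q ∈ E.erase e, (if q ∈ A then z else x) (φ q.1) (φ q.2) := by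
        intro φ
        rw [← Finset.mul_prod_erase E _ heE]
        congr 1
        · simp
        · refine Finset.prod_congr rfl fun q hq => ?_
          simp [Finset.ne_of_mem_erase hq]
      simp_rw [e1] at ih'
      simp_rw [e2]
      simp only [sub_mul, Finset.sum_sub_distrib] at st
      rw [Finset.card_insert_of_notMem heA]
      push_cast
      linarith
  refine (main E subset_rfl).trans (le_of_eq ?_)
  congr 1
  refine Finset.sum_congr rfl fun φ _ => Finset.prod_congr rfl fun q hq => by simp [hq]

lemma amgm_pow {ι : Type*} (E : Finset ι) (hE : E.Nonempty) (v : ι → ℝ) (hv : ∀ q ∈ E, 0 ≤ v q) :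
    ∏ q ∈ E, v q ≤ (1 / (E.card : ℝ)) * ∑ q ∈ E, v q ^ E.card := by
  have hc : (E.card : ℝ) ≠ 0 := by simpa using hE.ne_empty
  have := Real.geom_mean_le_arith_mean_weighted E (fun _ => 1 / (E.card : ℝ))
    (fun q => v q ^ E.card) (fun _ _ => by positivity) (by simp [hc])
    (fun q hq => pow_nonneg (hv q hq) _)
  rw [Finset.mul_sum]
  refine le_trans (le_of_eq ?_) this
  refine Finset.prod_congr rfl fun q hq => ?_
  rw [one_div, Real.pow_rpow_inv_natCast (hv q hq) (by simpa using hc)]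

lemma hom_le_pow {k n : ℕ} (z : Fin n → Fin n → ℝ) (hz0 : ∀ i j, 0 ≤ z i j)
    (E : Finset (Fin k × Fin k)) (hE : ∀ q ∈ E, q.1 < q.2) (hne : E.Nonempty) :
    (n:ℝ) ^ 2 * ∑ φ : Fin k → Fin n, ∏ q ∈ E, z (φ q.1) (φ q.2) ≤
      (n:ℝ) ^ k * ∑ i, ∑ j, z i j ^ E.card := by
  have hc : (E.card : ℝ) ≠ 0 := by simpa using hne.ne_empty
  calc (n:ℝ) ^ 2 * ∑ φ : Fin k → Fin n, ∏ q ∈ E, z (φ q.1) (φ q.2)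
      ≤ (n:ℝ) ^ 2 * ∑ φ : Fin k → Fin n, (1 / (E.card : ℝ)) * ∑ q ∈ E, z (φ q.1) (φ q.2) ^ E.card := by
        apply mul_le_mul_of_nonneg_left _ (by positivity)
        exact Finset.sum_le_sum fun φ _ => amgm_pow E hne _ (fun q _ => hz0 _ _)
    _ = (1 / (E.card : ℝ)) * ∑ q ∈ E, ((n:ℝ) ^ 2 * ∑ φ : Fin k → Fin n,
          z (φ q.1) (φ q.2) ^ E.card) := by
        rw [← Finset.mul_sum, Finset.sum_comm, ← Finset.mul_sum]; ring
    _ = (1 / (E.card : ℝ)) * ∑ q ∈ E, ((n:ℝ) ^ k * ∑ i, ∑ j, z i j ^ E.card) := by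
        congr 1
        refine Finset.sum_congr rfl fun q hq => ?_
        rw [← sum_update2 q.1 q.2]
        simp only [Function.update_self, Function.update_of_ne (hE q hq).ne]
        simp
    _ = _ := by
        rw [Finset.sum_const, nsmul_eq_mul]; field_simp

/-! ### Tangent lines of `h(u) = β₁ u + β₂ u ^ p` -/

noncomputable def bT (β₁ β₂ : ℝ) (p : ℕ) (t : ℝ) : ℝ := β₁ + β₂ * (p * t ^ (p - 1))
noncomputable def aT (β₁ β₂ : ℝ) (p : ℕ) (t : ℝ) : ℝ := β₁ * t + β₂ * t ^ p - bT β₁ β₂ p t * t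

lemma pow_tangent (m : ℕ) (t u : ℝ) (ht : 0 ≤ t) (hu : 0 ≤ u) :
    t ^ (m + 1) + (m + 1) * t ^ m * (u - t) ≤ u ^ (m + 1) := by
  induction m with
  | zero => simp
  | succ m ih =>
    have h1 := mul_le_mul_of_nonneg_left ih hu
    have h2 : 0 ≤ (m + 1) * t ^ m * (u - t) ^ 2 := by positivity
    push_cast
    calc _ = u * (t ^ (m + 1) + (m + 1) * t ^ m * (u - t)) - (m + 1) * t ^ m * (u - t) ^ 2 := by ring
      _ ≤ u * u ^ (m + 1) := by linarith
      _ = _ := by ring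

lemma pow_tangent' (p : ℕ) (hp : 1 ≤ p) (t u : ℝ) (ht : 0 ≤ t) (hu : 0 ≤ u) :
    t ^ p + p * t ^ (p - 1) * (u - t) ≤ u ^ p := by
  obtain ⟨m, rfl⟩ : ∃ m, p = m + 1 := ⟨p - 1, by omega⟩
  have := pow_tangent m t u ht hu
  simpa using this

lemma tangent_le (β₁ β₂ : ℝ) (hβ : 0 ≤ β₂) (p : ℕ) (hp : 1 ≤ p) (t u : ℝ) (ht : 0 ≤ t)
    (hu : 0 ≤ u) : aT β₁ β₂ p t + bT β₁ β₂ p t * u ≤ β₁ * u + β₂ * u ^ p := by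
  have := mul_le_mul_of_nonneg_left (pow_tangent' p hp t u ht hu) hβ
  unfold aT bT
  linarith

lemma tangent_approx (β₁ β₂ : ℝ) (hβ : 0 ≤ β₂) (p : ℕ) (hp : 1 ≤ p) (t u : ℝ) (ht : 0 ≤ t)
    (hu : 0 ≤ u) (ht1 : t ≤ 1) (hu1 : u ≤ 1) :
    β₁ * u + β₂ * u ^ p ≤ aT β₁ β₂ p t + bT β₁ β₂ p t * u + β₂ * p * |u - t| := by
  have h1 := mul_le_mul_of_nonneg_left (pow_tangent' p hp u t hu ht) hβ
  have h2 : (u ^ (p - 1) - t ^ (p - 1)) * (u - t) ≤ |u - t| := by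
    calc _ ≤ |(u ^ (p - 1) - t ^ (p - 1)) * (u - t)| := le_abs_self _
      _ = |u ^ (p - 1) - t ^ (p - 1)| * |u - t| := abs_mul _ _
      _ ≤ 1 * |u - t| := by
        apply mul_le_mul_of_nonneg_right _ (abs_nonneg _)
        have := pow_nonneg hu (p - 1)
        have := pow_nonneg ht (p - 1)
        have := pow_le_one₀ hu hu1 (n := p - 1)
        have := pow_le_one₀ ht ht1 (n := p - 1)
        rw [abs_le]; constructor <;> linarith
      _ = _ := one_mul _
  have h3 := mul_le_mul_of_nonneg_left h2 (mul_nonneg hβ (Nat.cast_nonneg (α := ℝ) p))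
  unfold aT bT
  linarith

lemma upper_det {k : ℕ} (E : Finset (Fin k × Fin k)) (hE : ∀ q ∈ E, q.1 < q.2) (hne : E.Nonempty)
    (β₁ β₂ : ℝ) (hβ : 0 ≤ β₂) (ε : ℝ) (hε : 0 < ε) :
    ∃ K L : ℕ, 0 < L ∧ ∀ n : ℕ, 0 < n → ∀ x : Fin n → Fin n → ℝ, (∀ i j, x i j = x j i) →
      (∀ i j, 0 ≤ x i j) → (∀ i j, x i j ≤ 1) →
      ∃ (P : Fin n → Fin K) (t : Fin K → Fin K → Fin (L + 1)), (∀ c d, t c d = t d c) ∧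
        β₁ * (∑ i, ∑ j, x i j) + β₂ * ((n:ℝ) ^ 2 / (n:ℝ) ^ k *
          ∑ φ : Fin k → Fin n, ∏ q ∈ E, x (φ q.1) (φ q.2)) ≤
        (∑ i, ∑ j, (aT β₁ β₂ E.card ((t (P i) (P j) : ℕ) / (L:ℝ)) +
          bT β₁ β₂ E.card ((t (P i) (P j) : ℕ) / (L:ℝ)) * x i j)) + (n:ℝ) ^ 2 * ε := by
  set p := E.card with hp
  have hp1 : 1 ≤ p := hne.card_pos
  set C := β₂ * p + 1 with hC
  have hC0 : 0 ≤ β₂ * p := by positivity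
  have hC1 : 0 < C := by linarith
  obtain ⟨K, hK⟩ := weak_regularity (ε / (2 * C)) (by positivity)
  obtain ⟨L, hL⟩ := exists_nat_gt (2 * C / ε)
  have hL0 : (0:ℝ) < L := lt_of_le_of_lt (by positivity) hL
  refine ⟨K, L, by exact_mod_cast hL0, fun n hn x hsym h0 h1 => ?_⟩
  have hnR : (0:ℝ) < n := by exact_mod_cast hn
  obtain ⟨P, hP, hcut⟩ := hK n x h0 h1
  have ha0 := blkAvg_nonneg P x h0
  have ha1 := blkAvg_le_one P x h1
  set v := blkAvg P x with hv
  have hfl : ∀ c d, ⌊v c d * L⌋₊ < L + 1 := by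
    intro c d
    have : v c d * L ≤ L := mul_le_of_le_one_left hL0.le (ha1 c d)
    have := Nat.floor_le_of_le this
    omega
  refine ⟨fun i => ⟨P i, hP i⟩, fun c d => ⟨⌊v c d * L⌋₊, hfl c d⟩, ?_, ?_⟩
  · intro c d
    simp only [hv, blkAvg_symm P x hsym c d]
  dsimp only
  set τ : ℕ → ℕ → ℝ := fun c d => (⌊v c d * L⌋₊ : ℝ) / L with hτ
  have hτ0 : ∀ c d, 0 ≤ τ c d := fun c d => by positivity
  have hτv : ∀ c d, τ c d ≤ v c d := fun c d => by
    rw [hτ]; simp only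
    rw [div_le_iff₀ hL0]
    exact Nat.floor_le (mul_nonneg (ha0 c d) hL0.le)
  have hvτ : ∀ c d, v c d - τ c d ≤ 1 / L := fun c d => by
    rw [hτ]; simp only
    rw [sub_le_iff_le_add, ← add_div, le_div_iff₀ hL0]
    have := Nat.lt_floor_add_one (v c d * L)
    linarith
  change _ ≤ (∑ i, ∑ j, (aT β₁ β₂ p (τ (P i) (P j)) + bT β₁ β₂ p (τ (P i) (P j)) * x i j)) + _
  have s1 := counting x (fun i j => v (P i) (P j)) _ hcut h0 h1 (fun i j => ha0 _ _)
    (fun i j => ha1 _ _) E hE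
  have s2 := hom_le_pow (fun i j => v (P i) (P j)) (fun i j => ha0 _ _) E hE hne
  rw [← hp] at s1 s2
  set X := ∑ φ : Fin k → Fin n, ∏ q ∈ E, x (φ q.1) (φ q.2)
  set Z := ∑ φ : Fin k → Fin n, ∏ q ∈ E, v (P (φ q.1)) (P (φ q.2))
  have hnk : (0:ℝ) < (n:ℝ) ^ k := by positivity
  have s3 : (n:ℝ) ^ 2 / (n:ℝ) ^ k * X ≤ ∑ i, ∑ j, v (P i) (P j) ^ p +
      p * (ε / (2 * C)) * (n:ℝ) ^ 2 := by
    rw [div_mul_eq_mul_div, div_le_iff₀ hnk]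
    have := mul_le_mul_of_nonneg_left s1 (sq_nonneg (n:ℝ))
    linarith
  have s4 := mul_le_mul_of_nonneg_left s3 hβ
  have s5 : β₂ * (p * (ε / (2 * C)) * (n:ℝ) ^ 2) ≤ ε / 2 * (n:ℝ) ^ 2 := by
    have : β₂ * p * (ε / (2 * C)) ≤ ε / 2 := by
      calc β₂ * p * (ε / (2 * C)) ≤ C * (ε / (2 * C)) := by
            apply mul_le_mul_of_nonneg_right (by linarith) (by positivity)
        _ = ε / 2 := by field_simp
    have := mul_le_mul_of_nonneg_right this (sq_nonneg (n:ℝ))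
    linarith
  have s6 : ∑ i, ∑ j, x i j = ∑ i, ∑ j, v (P i) (P j) := by
    have := blk_proj P x (fun _ _ => 1) (by intros; rfl)
    simp only [one_mul] at this
    exact this.symm
  have s7 : ∑ i, ∑ j, bT β₁ β₂ p (τ (P i) (P j)) * x i j =
      ∑ i, ∑ j, bT β₁ β₂ p (τ (P i) (P j)) * v (P i) (P j) := by
    refine (blk_proj P x (fun i j => bT β₁ β₂ p (τ (P i) (P j))) ?_).symm
    intro i i' j j' hi hj
    simp only [hi, hj]
  have s8 : ∀ c d, β₁ * v c d + β₂ * v c d ^ p ≤ aT β₁ β₂ p (τ c d) +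
      bT β₁ β₂ p (τ c d) * v c d + ε / 2 := by
    intro c d
    have h := tangent_approx β₁ β₂ hβ p hp1 (τ c d) (v c d) (hτ0 c d) (ha0 c d)
      ((hτv c d).trans (ha1 c d)) (ha1 c d)
    have h2 : β₂ * p * |v c d - τ c d| ≤ ε / 2 := by
      rw [abs_of_nonneg (by linarith [hτv c d])]
      calc β₂ * p * (v c d - τ c d) ≤ C * (1 / L) := by
            apply mul_le_mul (by linarith) (hvτ c d) (by linarith [hτv c d]) hC1.le
        _ ≤ ε / 2 := by
            rw [div_lt_iff₀ hε] at hL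
            rw [mul_one_div, div_le_iff₀ hL0]
            linarith
    linarith
  have s9 : ∑ i, ∑ j, (β₁ * v (P i) (P j) + β₂ * v (P i) (P j) ^ p) ≤
      ∑ i : Fin n, ∑ j : Fin n, (aT β₁ β₂ p (τ (P i) (P j)) +
      bT β₁ β₂ p (τ (P i) (P j)) * v (P i) (P j) + ε / 2) :=
    Finset.sum_le_sum fun i _ => Finset.sum_le_sum fun j _ => s8 _ _
  simp only [Finset.sum_add_distrib, ← Finset.mul_sum] at s9 ⊢
  have s10 : ∑ i : Fin n, ∑ j : Fin n, ε / 2 = (n:ℝ) ^ 2 * (ε / 2) := by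
    simp; ring
  rw [s10] at s9
  rw [s7, s6]
  linarith

/-! ### Symmetrized sums -/

noncomputable def mult {n : ℕ} (i j : Fin n) : ℝ := if i < j then 2 else if i = j then 1 else 0

lemma sum_symm {n : ℕ} (X : Fin n → Fin n → ℝ) (hX : ∀ i j, X i j = X j i) :
    ∑ i, ∑ j, X i j = ∑ i, ∑ j, mult i j * X i j := by
  have e1 : ∀ i j, X i j = (if i < j then X i j else 0) + (if i = j then X i j else 0)
      + (if j < i then X j i else 0) := by
    intro i j
    rcases lt_trichotomy i j with h | h | h
    · simp [h, h.ne, h.not_gt]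
    · simp [h]
    · simp [h, h.ne', h.not_gt, hX j i]
  have e2 : ∑ i, ∑ j, (if j < i then X j i else 0) = ∑ i, ∑ j, (if i < j then X i j else 0) :=
    Finset.sum_comm
  calc ∑ i, ∑ j, X i j = ∑ i, ∑ j, ((if i < j then X i j else 0) + (if i = j then X i j else 0)
      + (if j < i then X j i else 0)) :=
        Finset.sum_congr rfl fun i _ => Finset.sum_congr rfl fun j _ => e1 i j
    _ = ∑ i, ∑ j, ((if i < j then X i j else 0) + (if i = j then X i j else 0)
      + (if i < j then X i j else 0)) := by
        simp only [Finset.sum_add_distrib, e2]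
    _ = _ := by
        refine Finset.sum_congr rfl fun i _ => Finset.sum_congr rfl fun j _ => ?_
        unfold mult
        rcases lt_trichotomy i j with h | h | h
        · simp [h, h.ne]; ring
        · simp [h]
        · simp [h.ne', h.not_gt]

lemma symWeight_symm {n : ℕ} (w : Fin n → Fin n → ℝ) (i j : Fin n) :
    symWeight w i j = symWeight w j i := by
  unfold symWeight
  rcases lt_trichotomy i j with h | h | h
  · simp [h.le, h.not_ge]
  · simp [h]
  · simp [h.le, h.not_ge]

lemma mult_mul_sym {n : ℕ} (w : Fin n → Fin n → ℝ) (i j : Fin n) :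
    mult i j * symWeight w i j = mult i j * w i j := by
  unfold mult symWeight
  rcases lt_trichotomy i j with h | h | h
  · simp [h.le]
  · simp [h]
  · simp [h.not_gt, h.ne']

lemma symWeight_cont {n : ℕ} (i j : Fin n) :
    Continuous fun w : Fin n → Fin n → ℝ => symWeight w i j := by
  unfold symWeight; split_ifs <;> fun_prop

lemma upper_integral {n : ℕ} (a b : Fin n → Fin n → ℝ) (ha : ∀ i j, a i j = a j i)
    (hb : ∀ i j, b i j = b j i) (S : ℝ) (hS : ∀ i j, a i j + Lam (2 * b i j) / 2 ≤ S) :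
    ∫ w, Real.exp (∑ i, ∑ j, (a i j + b i j * symWeight w i j)) ∂(weightMeasure n) ≤
      Real.exp ((n:ℝ) ^ 2 * S) := by
  have e1 : ∀ w : Fin n → Fin n → ℝ, Real.exp (∑ i, ∑ j, (a i j + b i j * symWeight w i j)) =
      ∏ i, ∏ j, Real.exp (mult i j * a i j + mult i j * b i j * w i j) := by
    intro w
    rw [sum_symm _ (by intro i j; rw [ha, hb, symWeight_symm]), Real.exp_sum]
    refine Finset.prod_congr rfl fun i _ => ?_
    rw [Real.exp_sum]
    refine Finset.prod_congr rfl fun j _ => ?_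
    have := mult_mul_sym w i j
    congr 1
    calc _ = mult i j * a i j + b i j * (mult i j * symWeight w i j) := by ring
      _ = _ := by rw [this]; ring
  simp_rw [e1]
  rw [weight_integral_prod (fun i j x => Real.exp (mult i j * a i j + mult i j * b i j * x))]
  have e2 : ∀ i j : Fin n, ∫ x, Real.exp (mult i j * a i j + mult i j * b i j * x) ∂unifMeasure =
      Real.exp (mult i j * a i j + Lam (mult i j * b i j)) := by
    intro i j
    simp_rw [Real.exp_add]
    rw [integral_const_mul, Lam, Real.exp_log (Mu_pos _)]; rfl
  simp_rw [e2]
  have e3 : (n:ℝ) ^ 2 * S = ∑ i : Fin n, ∑ j : Fin n, mult i j * S := by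
    rw [← sum_symm (fun _ _ => S) (fun _ _ => rfl)]; simp; ring
  rw [e3, Real.exp_sum]
  refine Finset.prod_le_prod (fun i _ => Finset.prod_nonneg fun j _ => (Real.exp_pos _).le) fun i _ => ?_
  rw [Real.exp_sum]
  refine Finset.prod_le_prod (fun j _ => (Real.exp_pos _).le) fun j _ => ?_
  rw [Real.exp_le_exp]
  have h := hS i j
  have h2 := Lam_double (b i j)
  unfold mult
  split_ifs
  · linarith
  · rw [one_mul, one_mul]; linarith
  · simp [Lam_zero]

lemma symWeight_mem {n : ℕ} {w : Fin n → Fin n → ℝ} (hw : ∀ i j, w i j ∈ Set.Icc (0:ℝ) 1)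
    (i j : Fin n) : symWeight w i j ∈ Set.Icc (0:ℝ) 1 := by
  unfold symWeight; split_ifs <;> apply hw

/-- the ordered edge set -/
def ordE {k : ℕ} (H : SimpleGraph (Fin k)) [DecidableRel H.Adj] : Finset (Fin k × Fin k) :=
  Finset.univ.filter (fun q : Fin k × Fin k => H.Adj q.1 q.2 ∧ q.1 < q.2)

lemma ordE_lt {k : ℕ} (H : SimpleGraph (Fin k)) [DecidableRel H.Adj] :
    ∀ q ∈ ordE H, q.1 < q.2 := by
  intro q hq; simp only [ordE, Finset.mem_filter] at hq; exact hq.2.2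

lemma ordE_card {k : ℕ} (H : SimpleGraph (Fin k)) [DecidableRel H.Adj] :
    H.edgeFinset.card = (ordE H).card := by
  symm
  apply Finset.card_bij (fun q _ => s(q.1, q.2))
  · intro q hq
    simp only [ordE, Finset.mem_filter] at hq
    simpa using hq.2.1
  · intro q hq q' hq' h
    have h1 := ordE_lt H q hq
    have h2 := ordE_lt H q' hq'
    rw [Sym2.eq_iff] at h
    rcases h with h | h
    · exact Prod.ext h.1 h.2
    · rw [h.1, h.2] at h1
      exact absurd h1 h2.not_gt
  · intro e
    induction e using Sym2.ind with
    | _ a b =>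
      intro he
      have he : H.Adj a b := by simpa using he
      rcases lt_or_gt_of_ne he.ne with h | h
      · exact ⟨(a, b), by simp [ordE, he, h], rfl⟩
      · exact ⟨(b, a), by simp [ordE, he.symm, h], Sym2.eq_swap⟩

lemma exponent_eq {k n : ℕ} (hn : 0 < n) (H : SimpleGraph (Fin k)) [DecidableRel H.Adj]
    (β₁ β₂ : ℝ) (w : Fin n → Fin n → ℝ) :
    (n : ℝ) ^ 2 * (β₁ * edgeDensity w + β₂ * homDensity H w) =
      β₁ * (∑ i, ∑ j, symWeight w i j) + β₂ * ((n:ℝ) ^ 2 / (n:ℝ) ^ k *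
          ∑ φ : Fin k → Fin n, ∏ q ∈ ordE H, symWeight w (φ q.1) (φ q.2)) := by
  have : (n:ℝ) ≠ 0 := by positivity
  unfold edgeDensity homDensity ordE
  field_simp

lemma exponent_cont {k n : ℕ} (H : SimpleGraph (Fin k)) [DecidableRel H.Adj]
    (β₁ β₂ : ℝ) : Continuous fun w : Fin n → Fin n → ℝ =>
    (n : ℝ) ^ 2 * (β₁ * edgeDensity w + β₂ * homDensity H w) := by
  have := @symWeight_cont n
  unfold edgeDensity homDensity
  fun_prop

lemma psi_upper {k : ℕ} (H : SimpleGraph (Fin k)) [DecidableRel H.Adj] (p : ℕ)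
    (hp : p = (ordE H).card) (hp1 : 1 ≤ p) (β₁ β₂ : ℝ) (hβ : 0 ≤ β₂) (S : ℝ)
    (hS : ∀ t ∈ Set.Icc (0:ℝ) 1, aT β₁ β₂ p t + Lam (2 * bT β₁ β₂ p t) / 2 ≤ S)
    (ε : ℝ) (hε : 0 < ε) : ∃ A B : ℝ, ∀ n : ℕ, 0 < n →
      psiERGM H β₁ β₂ n ≤ S + ε + A / n + B / (n:ℝ) ^ 2 := by
  classical
  obtain ⟨K, L, hL, hdet⟩ := upper_det (ordE H) (ordE_lt H)
    (Finset.card_pos.mp (by omega)) β₁ β₂ hβ ε hε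
  rw [← hp] at hdet
  set 𝒯 := {t : Fin K → Fin K → Fin (L + 1) // ∀ c d, t c d = t d c}
  set C := Fintype.card 𝒯
  refine ⟨Real.log K, Real.log C, fun n hn => ?_⟩
  have hnR : (0:ℝ) < n := by exact_mod_cast hn
  have hLR : (0:ℝ) < L := by exact_mod_cast hL
  let G : (Fin n → Fin K) × 𝒯 → (Fin n → Fin n → ℝ) → ℝ := fun z w =>
    Real.exp (∑ i, ∑ j, (aT β₁ β₂ p ((z.2.1 (z.1 i) (z.1 j) : ℕ) / (L:ℝ)) +
          bT β₁ β₂ p ((z.2.1 (z.1 i) (z.1 j) : ℕ) / (L:ℝ)) * symWeight w i j))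
  have hGc : ∀ z, Continuous (G z) := by
    intro z
    have := @symWeight_cont n
    simp only [G]
    fun_prop
  have hGi : ∀ z, ∫ w, G z w ∂(weightMeasure n) ≤ Real.exp ((n:ℝ) ^ 2 * S) := by
    intro z
    apply upper_integral
    · intro i j; rw [z.2.2]
    · intro i j; rw [z.2.2]
    · intro i j
      apply hS
      refine ⟨by positivity, ?_⟩
      rw [div_le_one hLR]
      exact_mod_cast Nat.lt_succ_iff.mp (z.2.1 (z.1 i) (z.1 j)).2
  have hmain : ∫ w, Real.exp ((n : ℝ) ^ 2 * (β₁ * edgeDensity w + β₂ * homDensity H w))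
      ∂(weightMeasure n) ≤ (K:ℝ) ^ n * C * Real.exp ((n:ℝ) ^ 2 * (S + ε)) := by
    calc _ ≤ ∫ w, (∑ z, G z w) * Real.exp ((n:ℝ) ^ 2 * ε) ∂(weightMeasure n) := by
          apply integral_mono_ae (weight_integrable (Real.continuous_exp.comp (exponent_cont H β₁ β₂)))
            (weight_integrable (by fun_prop))
          filter_upwards [weight_ae n] with w hw
          rw [Function.comp, exponent_eq hn]
          obtain ⟨P, t, ht, hle⟩ := hdet n hn (symWeight w) (symWeight_symm w)
            (fun i j => (symWeight_mem hw i j).1) (fun i j => (symWeight_mem hw i j).2)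
          calc _ ≤ _ := Real.exp_le_exp.mpr hle
            _ = G (P, ⟨t, ht⟩) w * Real.exp ((n:ℝ) ^ 2 * ε) := by rw [Real.exp_add]
            _ ≤ _ := by
              apply mul_le_mul_of_nonneg_right _ (Real.exp_pos _).le
              exact Finset.single_le_sum (f := fun z => G z w) (fun z _ => (Real.exp_pos _).le)
                (Finset.mem_univ _)
      _ = (∑ z, ∫ w, G z w ∂(weightMeasure n)) * Real.exp ((n:ℝ) ^ 2 * ε) := by
          rw [integral_mul_const, integral_finsetSum _ (fun z _ => weight_integrable (hGc z))]
      _ ≤ (∑ z : (Fin n → Fin K) × 𝒯, Real.exp ((n:ℝ) ^ 2 * S)) * Real.exp ((n:ℝ) ^ 2 * ε) := by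
          apply mul_le_mul_of_nonneg_right _ (Real.exp_pos _).le
          exact Finset.sum_le_sum fun z _ => hGi z
      _ = _ := by
          rw [Finset.sum_const, Finset.card_univ, Fintype.card_prod, nsmul_eq_mul, mul_assoc,
            ← Real.exp_add, mul_add]
          simp [C]
  have hpos : 0 < ∫ w, Real.exp ((n : ℝ) ^ 2 * (β₁ * edgeDensity w + β₂ * homDensity H w))
      ∂(weightMeasure n) :=
    integral_exp_pos (weight_integrable (Real.continuous_exp.comp (exponent_cont H β₁ β₂)))
  have hN : (K:ℝ) ^ n * C ≠ 0 := by
    intro h; rw [h, zero_mul] at hmain; linarith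
  have hlog := Real.log_le_log hpos hmain
  rw [Real.log_mul hN (Real.exp_pos _).ne', Real.log_exp,
    Real.log_mul (left_ne_zero_of_mul hN) (right_ne_zero_of_mul hN), Real.log_pow] at hlog
  unfold psiERGM
  have := mul_le_mul_of_nonneg_left hlog (by positivity : 0 ≤ 1 / (n:ℝ) ^ 2)
  refine this.trans (le_of_eq ?_)
  field_simp
  ring

/-! ### Lower bound -/

lemma jensen_lower {n : ℕ} (F T : (Fin n → Fin n → ℝ) → ℝ) (hF : Continuous F) (hT : Continuous T)
    (h1 : ∫ w, Real.exp (T w) ∂(weightMeasure n) = 1) (c : ℝ)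
    (hc : c ≤ ∫ w, (F w - T w) * Real.exp (T w) ∂(weightMeasure n)) :
    Real.exp c ≤ ∫ w, Real.exp (F w) ∂(weightMeasure n) := by
  have key : ∫ w, (Real.exp c * ((1 - c) * Real.exp (T w) + (F w - T w) * Real.exp (T w)))
      ∂(weightMeasure n) ≤ ∫ w, Real.exp (F w) ∂(weightMeasure n) := by
    apply integral_mono (weight_integrable (by fun_prop)) (weight_integrable (by fun_prop))
    intro w
    have h2 := Real.add_one_le_exp (F w - T w - c)
    have h3 : Real.exp (F w) = Real.exp c * (Real.exp (T w) * Real.exp (F w - T w - c)) := by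
      rw [← Real.exp_add, ← Real.exp_add]; congr 1; ring
    show _ ≤ Real.exp (F w)
    rw [h3]
    apply mul_le_mul_of_nonneg_left _ (Real.exp_pos _).le
    have := mul_le_mul_of_nonneg_left h2 (Real.exp_pos (T w)).le
    linarith
  rw [integral_const_mul, integral_add (weight_integrable (by fun_prop))
    (weight_integrable (by fun_prop)), integral_const_mul, h1] at key
  refine le_trans ?_ key
  apply le_mul_of_one_le_right (Real.exp_pos _).le
  linarith

noncomputable def ind {n : ℕ} (i j : Fin n) : ℝ := if i ≤ j then 1 else 0

noncomputable def tiltT (θ : ℝ) {n : ℕ} (w : Fin n → Fin n → ℝ) : ℝ :=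
  ∑ i, ∑ j, ind i j * (θ * w i j - Lam θ)

lemma tiltT_cont (θ : ℝ) {n : ℕ} : Continuous (tiltT θ (n := n)) := by
  unfold tiltT; fun_prop

lemma tilt_prod (θ : ℝ) {n : ℕ} (A : Finset (Fin n × Fin n)) (hA : ∀ q ∈ A, q.1 ≤ q.2) :
    ∫ w, (∏ q ∈ A, w q.1 q.2) * Real.exp (tiltT θ w) ∂(weightMeasure n) = um θ ^ A.card := by
  classical
  have e1 : ∀ w : Fin n → Fin n → ℝ, (∏ q ∈ A, w q.1 q.2) * Real.exp (tiltT θ w) =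
      ∏ i, ∏ j, ((if (i, j) ∈ A then w i j else 1) * Real.exp (ind i j * (θ * w i j - Lam θ))) := by
    intro w
    simp only [Finset.prod_mul_distrib]
    congr 1
    · rw [← Fintype.prod_prod_type' (fun i j => if (i, j) ∈ A then w i j else 1)]
      simp [Finset.prod_ite_mem]
    · rw [tiltT, Real.exp_sum]
      refine Finset.prod_congr rfl fun i _ => ?_
      rw [Real.exp_sum]
  simp_rw [e1]
  rw [weight_integral_prod (fun i j x => (if (i, j) ∈ A then x else 1) *
    Real.exp (ind i j * (θ * x - Lam θ)))]
  have e2 : ∀ i j : Fin n, ∫ x, (if (i, j) ∈ A then x else 1) *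
    Real.exp (ind i j * (θ * x - Lam θ)) ∂unifMeasure = if (i, j) ∈ A then um θ else 1 := by
    intro i j
    split_ifs with h
    · have := hA _ h
      simp only at this
      simp only [ind, this, if_true, one_mul]
      rfl
    · unfold ind
      split_ifs
      · simp only [one_mul]; exact tilt_one θ
      · simp
  simp_rw [e2]
  rw [← Fintype.prod_prod_type' (fun i j => if (i, j) ∈ A then um θ else 1)]
  simp [Finset.prod_ite_mem]

lemma tilt_total (θ : ℝ) {n : ℕ} : ∫ w, Real.exp (tiltT θ w) ∂(weightMeasure n) = 1 := by
  simpa using tilt_prod θ (n := n) ∅ (by simp)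

lemma tilt_single (θ : ℝ) {n : ℕ} (i j : Fin n) (h : i ≤ j) :
    ∫ w, w i j * Real.exp (tiltT θ w) ∂(weightMeasure n) = um θ := by
  simpa using tilt_prod θ (n := n) {(i, j)} (by simpa using h)

lemma symWeight_minmax {n : ℕ} (w : Fin n → Fin n → ℝ) (i j : Fin n) :
    symWeight w i j = w (min i j) (max i j) := by
  unfold symWeight
  split_ifs with h
  · simp [h]
  · have := (not_le.mp h).le; simp [this]

lemma tilt_sym (θ : ℝ) {n : ℕ} (i j : Fin n) :
    ∫ w, symWeight w i j * Real.exp (tiltT θ w) ∂(weightMeasure n) = um θ := by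
  simp_rw [symWeight_minmax]
  exact tilt_single θ _ _ min_le_max

lemma tilt_inj (θ : ℝ) {k n : ℕ} (E : Finset (Fin k × Fin k)) (hE : ∀ q ∈ E, q.1 < q.2)
    (φ : Fin k → Fin n) (hφ : Function.Injective φ) :
    ∫ w, (∏ q ∈ E, symWeight w (φ q.1) (φ q.2)) * Real.exp (tiltT θ w) ∂(weightMeasure n) =
      um θ ^ E.card := by
  classical
  let s : Fin k × Fin k → Fin n × Fin n := fun q =>
    (min (φ q.1) (φ q.2), max (φ q.1) (φ q.2))
  have hs : Set.InjOn s E := by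
    intro q hq q' hq' h
    have h1 := hE q hq
    have h2 := hE q' hq'
    simp only [s, Prod.mk.injEq] at h
    have h3 : s(φ q.1, φ q.2) = s(φ q'.1, φ q'.2) := by
      rw [Sym2.eq_iff]
      rcases le_total (φ q.1) (φ q.2) with a | a <;> rcases le_total (φ q'.1) (φ q'.2) with b | b <;>
        simp only [a, b, min_eq_left, min_eq_right, max_eq_left, max_eq_right] at h <;> tauto
    rw [Sym2.eq_iff] at h3
    rcases h3 with h | h
    · exact Prod.ext (hφ h.1) (hφ h.2)
    · rw [hφ h.1, hφ h.2] at h1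
      exact absurd h1 h2.not_gt
  have := tilt_prod θ (E.image s) (by
    intro r hr
    obtain ⟨q, _, rfl⟩ := Finset.mem_image.mp hr
    exact min_le_max)
  rw [Finset.card_image_of_injOn hs] at this
  rw [← this]
  congr 1
  ext w
  rw [Finset.prod_image hs]
  simp only [s, symWeight_minmax]

lemma sum_ind {n : ℕ} : ∑ i : Fin n, ∑ j : Fin n, ind i j = ((n:ℝ) ^ 2 + n) / 2 := by
  have h1 : ∑ i : Fin n, ∑ j : Fin n, ind i j = ∑ i : Fin n, ∑ j : Fin n, ind j i := Finset.sum_comm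
  have h2 : ∑ i : Fin n, ∑ j : Fin n, ind i j + ∑ i : Fin n, ∑ j : Fin n, ind j i
      = ∑ i : Fin n, ∑ j : Fin n, ((1:ℝ) + if i = j then 1 else 0) := by
    simp only [← Finset.sum_add_distrib]
    refine Finset.sum_congr rfl fun i _ => Finset.sum_congr rfl fun j _ => ?_
    unfold ind
    rcases lt_trichotomy i j with h | h | h
    · simp [h.le, h.not_ge, h.ne]
    · simp [h]
    · simp [h.le, h.not_ge, h.ne']
  have h3 : ∑ i : Fin n, ∑ j : Fin n, ((1:ℝ) + if i = j then 1 else 0) = (n:ℝ) ^ 2 + n := by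
    simp [Finset.sum_add_distrib]; ring
  linarith

lemma psi_lower {k : ℕ} (H : SimpleGraph (Fin k)) [DecidableRel H.Adj] (p : ℕ)
    (hp : p = (ordE H).card) (β₁ β₂ : ℝ) (hβ : 0 ≤ β₂) (θ : ℝ) (n : ℕ) (hn : 0 < n) :
    β₁ * um θ + β₂ * (((n.descFactorial k : ℕ) : ℝ) / (n:ℝ) ^ k * um θ ^ p)
      - (1 + 1 / (n:ℝ)) / 2 * (θ * um θ - Lam θ) ≤ psiERGM H β₁ β₂ n := by
  classical
  have hnR : (0:ℝ) < n := by exact_mod_cast hn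
  set u := um θ
  have hsc := @symWeight_cont n
  have hTc := tiltT_cont θ (n := n)
  let J : Finset (Fin k → Fin n) := Finset.univ.filter Function.Injective
  have hJ : J.card = n.descFactorial k := by
    have := Fintype.card_congr (Equiv.subtypeInjectiveEquivEmbedding (Fin k) (Fin n))
    rw [Fintype.card_embedding_eq, Fintype.card_fin, Fintype.card_fin, Fintype.card_subtype] at this
    exact this
  let F : (Fin n → Fin n → ℝ) → ℝ := fun w => β₁ * (∑ i, ∑ j, symWeight w i j) +
    β₂ * ((n:ℝ) ^ 2 / (n:ℝ) ^ k * ∑ φ ∈ J, ∏ q ∈ ordE H, symWeight w (φ q.1) (φ q.2))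
  have hFc : Continuous F := by simp only [F]; fun_prop
  set c := β₁ * ((n:ℝ) ^ 2 * u) + β₂ * ((n:ℝ) ^ 2 / (n:ℝ) ^ k * (J.card * u ^ p))
    - ((n:ℝ) ^ 2 + n) / 2 * (θ * u - Lam θ) with hc
  have hcEq : c = ∫ w, (F w - tiltT θ w) * Real.exp (tiltT θ w) ∂(weightMeasure n) := by
    have e1 : ∀ w : Fin n → Fin n → ℝ, (F w - tiltT θ w) * Real.exp (tiltT θ w) =
        β₁ * (∑ i, ∑ j, symWeight w i j * Real.exp (tiltT θ w)) +
        β₂ * ((n:ℝ) ^ 2 / (n:ℝ) ^ k * ∑ φ ∈ J, (∏ q ∈ ordE H, symWeight w (φ q.1) (φ q.2)) *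
          Real.exp (tiltT θ w)) -
        ∑ i, ∑ j, ind i j * (θ * (w i j * Real.exp (tiltT θ w)) - Lam θ * Real.exp (tiltT θ w)) := by
      intro w
      have : tiltT θ w * Real.exp (tiltT θ w) = ∑ i, ∑ j, ind i j *
          (θ * (w i j * Real.exp (tiltT θ w)) - Lam θ * Real.exp (tiltT θ w)) := by
        conv_lhs => rw [tiltT]
        simp only [Finset.sum_mul]
        refine Finset.sum_congr rfl fun i _ => Finset.sum_congr rfl fun j _ => ?_
        unfold tiltT
        ring
      rw [sub_mul, this]
      simp only [F, ← Finset.sum_mul]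
      ring
    simp_rw [e1]
    rw [integral_sub (weight_integrable (by fun_prop)) (weight_integrable (by fun_prop)),
      integral_add (weight_integrable (by fun_prop)) (weight_integrable (by fun_prop)),
      integral_const_mul, integral_const_mul, integral_const_mul,
      integral_finsetSum _ (fun i _ => weight_integrable (by fun_prop)),
      integral_finsetSum _ (fun i _ => weight_integrable (by fun_prop)),
      integral_finsetSum _ (fun i _ => weight_integrable (by fun_prop))]
    have t1 : ∀ i : Fin n, ∫ w, ∑ j, symWeight w i j * Real.exp (tiltT θ w) ∂(weightMeasure n)
        = n * u := by
      intro i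
      rw [integral_finsetSum _ (fun i _ => weight_integrable (by fun_prop))]
      simp only [tilt_sym]; simp [u]
    have t2 : ∀ φ ∈ J, ∫ w, (∏ q ∈ ordE H, symWeight w (φ q.1) (φ q.2)) *
          Real.exp (tiltT θ w) ∂(weightMeasure n) = u ^ p := by
      intro φ hφ
      rw [tilt_inj θ _ (ordE_lt H) φ (Finset.mem_filter.mp hφ).2, hp]
    have t3 : ∀ i : Fin n, ∫ w, ∑ j, ind i j * (θ * (w i j * Real.exp (tiltT θ w)) -
        Lam θ * Real.exp (tiltT θ w)) ∂(weightMeasure n) = (∑ j, ind i j) * (θ * u - Lam θ) := by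
      intro i
      rw [integral_finsetSum _ (fun i _ => weight_integrable (by fun_prop)), Finset.sum_mul]
      refine Finset.sum_congr rfl fun j _ => ?_
      rw [integral_const_mul]
      by_cases h : i ≤ j
      · rw [integral_sub (weight_integrable (by fun_prop)) (weight_integrable (by fun_prop)),
          integral_const_mul, integral_const_mul, tilt_single θ i j h, tilt_total, mul_one]
      · simp [ind, h]
    rw [Finset.sum_congr rfl (fun i _ => t1 i), Finset.sum_congr rfl t2,
      Finset.sum_congr rfl (fun i _ => t3 i)]
    rw [← Finset.sum_mul (f := fun i : Fin n => ∑ j, ind i j), sum_ind]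
    simp only [Finset.sum_const, nsmul_eq_mul, Finset.card_univ, Fintype.card_fin]
    rw [hc]; ring
  have hj := jensen_lower F (tiltT θ) hFc hTc (tilt_total θ) c hcEq.le
  have hFE : ∫ w, Real.exp (F w) ∂(weightMeasure n) ≤
      ∫ w, Real.exp ((n : ℝ) ^ 2 * (β₁ * edgeDensity w + β₂ * homDensity H w)) ∂(weightMeasure n) := by
    apply integral_mono_ae (weight_integrable (by fun_prop))
      (weight_integrable (Real.continuous_exp.comp (exponent_cont H β₁ β₂)))
    filter_upwards [weight_ae n] with w hw
    rw [Function.comp, exponent_eq hn, Real.exp_le_exp]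
    simp only [F]
    have : ∑ φ ∈ J, ∏ q ∈ ordE H, symWeight w (φ q.1) (φ q.2) ≤
        ∑ φ : Fin k → Fin n, ∏ q ∈ ordE H, symWeight w (φ q.1) (φ q.2) :=
      Finset.sum_le_sum_of_subset_of_nonneg (Finset.subset_univ _)
        (fun φ _ _ => Finset.prod_nonneg fun q _ => (symWeight_mem hw _ _).1)
    gcongr
  have hlog := (Real.le_log_iff_exp_le (lt_of_lt_of_le (Real.exp_pos c) (hj.trans hFE))).mpr
    (hj.trans hFE)
  unfold psiERGM
  refine le_trans (le_of_eq ?_) (mul_le_mul_of_nonneg_left hlog (by positivity : 0 ≤ 1 / (n:ℝ) ^ 2))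
  rw [hc, hJ]
  field_simp

lemma descFactorial_lim (k : ℕ) :
    Tendsto (fun n : ℕ => ((n.descFactorial k : ℕ) : ℝ) / (n:ℝ) ^ k) atTop (nhds 1) := by
  induction k with
  | zero => simp
  | succ k ih =>
    have h2 : Tendsto (fun n : ℕ => (1:ℝ) - k / n) atTop (nhds (1 - 0)) :=
      tendsto_const_nhds.sub (tendsto_const_div_atTop_nhds_zero_nat (k:ℝ))
    have := h2.mul ih
    rw [sub_zero, one_mul] at this
    refine this.congr' ?_
    filter_upwards [eventually_ge_atTop (k + 1)] with n hn
    rw [Nat.descFactorial_succ, Nat.cast_mul, Nat.cast_sub (by omega)]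
    have : (n:ℝ) ≠ 0 := by
      have : 0 < n := by omega
      positivity
    field_simp
    ring

lemma psi_tendsto {k : ℕ} (H : SimpleGraph (Fin k)) [DecidableRel H.Adj] (p : ℕ)
    (hp : p = (ordE H).card) (hp1 : 1 ≤ p) (β₁ β₂ : ℝ) (hβ : 0 ≤ β₂) (S : ℝ)
    (hS : ∀ t ∈ Set.Icc (0:ℝ) 1, aT β₁ β₂ p t + Lam (2 * bT β₁ β₂ p t) / 2 ≤ S)
    (hS' : ∀ c < S, ∃ t ∈ Set.Icc (0:ℝ) 1, c < aT β₁ β₂ p t + Lam (2 * bT β₁ β₂ p t) / 2) :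
    Tendsto (fun n : ℕ => psiERGM H β₁ β₂ n) atTop (nhds S) := by
  rw [tendsto_order]
  constructor
  · intro c hc
    obtain ⟨t, ht, hct⟩ := hS' c hc
    set θ := 2 * bT β₁ β₂ p t with hθ
    have htan := tangent_le β₁ β₂ hβ p hp1 t (um θ) ht.1 (um_nonneg θ)
    have hlim : Tendsto (fun n : ℕ => β₁ * um θ +
        β₂ * (((n.descFactorial k : ℕ) : ℝ) / (n:ℝ) ^ k * um θ ^ p)
        - (1 + 1 / (n:ℝ)) / 2 * (θ * um θ - Lam θ)) atTop
        (nhds (β₁ * um θ + β₂ * (1 * um θ ^ p) - (1 + 0) / 2 * (θ * um θ - Lam θ))) := by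
      refine Tendsto.sub (tendsto_const_nhds.add (((descFactorial_lim k).mul_const _).const_mul _)) ?_
      exact ((tendsto_const_nhds.add (tendsto_const_div_atTop_nhds_zero_nat 1)).div_const _).mul_const _
    have hlt : c < β₁ * um θ + β₂ * (1 * um θ ^ p) - (1 + 0) / 2 * (θ * um θ - Lam θ) := by
      have : bT β₁ β₂ p t * um θ = θ * um θ / 2 := by rw [hθ]; ring
      linarith
    filter_upwards [(tendsto_order.mp hlim).1 c hlt, eventually_gt_atTop 0] with n h1 h2
    exact h1.trans_le (psi_lower H p hp β₁ β₂ hβ θ n h2)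
  · intro c hc
    obtain ⟨A, B, hAB⟩ := psi_upper H p hp hp1 β₁ β₂ hβ S hS ((c - S) / 2) (by linarith)
    have hlim : Tendsto (fun n : ℕ => S + (c - S) / 2 + A / n + B / (n:ℝ) ^ 2) atTop
        (nhds (S + (c - S) / 2 + 0 + 0)) := by
      refine (tendsto_const_nhds.add (tendsto_const_div_atTop_nhds_zero_nat A)).add ?_
      exact tendsto_const_div_pow B 2 (by norm_num)
    filter_upwards [(tendsto_order.mp hlim).2 c (by linarith), eventually_gt_atTop 0] with n h1 h2
    exact (hAB n h2).trans_lt h1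


/-- For the 2-parameter edge-weighted exponential random graph model with uniform(0,1)
edge weights, edge term and a subgraph `H₂` with `p ≥ 2` edges, in the region `β₂ ≥ 0`
the limiting normalization constant equals
`ψ_∞^β = sup_{0 ≤ u ≤ 1} (β₁ u + β₂ u^p - (1/2) I(u))` where `I` is the Cramér rate
function of the uniform(0,1) distribution (EReal-valued, `+∞` outside `(0,1)`);
moreover, for `p = 2` and `β₂ = -β₁`, the function
`l(u) = β₁(u - u²) - (1/2) I(u)` satisfies `l(u) = l(1-u)` on `(0,1)`. -/
theorem ergm_uniform_variational_and_symmetry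
    {k : ℕ} (H₂ : SimpleGraph (Fin k)) [DecidableRel H₂.Adj]
    (p : ℕ) (hpdef : p = H₂.edgeFinset.card) (hp : 2 ≤ p)
    (M : ℝ → ℝ) (hM : ∀ θ : ℝ, M θ = if θ = 0 then 1 else (Real.exp θ - 1) / θ)
    (I : ℝ → EReal)
    (hI : ∀ u : ℝ, I u = ⨆ θ : ℝ, ((θ * u - Real.log (M θ) : ℝ) : EReal)) :
    (∀ β₁ β₂ : ℝ, 0 ≤ β₂ →
      Tendsto (fun n : ℕ => ((psiERGM H₂ β₁ β₂ n : ℝ) : EReal)) atTop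
        (nhds (sSup ((fun u : ℝ =>
          ((β₁ * u + β₂ * u ^ p : ℝ) : EReal) - ((1/2 : ℝ) : EReal) * I u) ''
            Set.Icc (0:ℝ) 1)))) ∧
    (p = 2 → ∀ β₁ : ℝ, ∀ u ∈ Set.Ioo (0:ℝ) 1,
      ((β₁ * (u - u ^ 2) : ℝ) : EReal) - ((1/2 : ℝ) : EReal) * I u =
      ((β₁ * ((1 - u) - (1 - u) ^ 2) : ℝ) : EReal) - ((1/2 : ℝ) : EReal) * I (1 - u)) := by
  have hML : ∀ θ, Real.log (M θ) = Lam θ := by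
    intro θ; rw [hM, Lam, Mu_eq]
  simp only [hML] at hI
  have hIsymm : ∀ u, I (1 - u) = I u := by
    intro u
    rw [hI, hI]
    refine (Equiv.iSup_congr (Equiv.neg ℝ) ?_)
    intro θ
    simp only [Equiv.neg_apply]
    rw [Lam_neg]
    congr 1
    ring
  refine ⟨?_, ?_⟩
  · intro β₁ β₂ hβ
    have hpE : p = (ordE H₂).card := by rw [hpdef, ordE_card]
    have hp1 : 1 ≤ p := by omega
    set G : ℝ → ℝ := fun t => aT β₁ β₂ p t + Lam (2 * bT β₁ β₂ p t) / 2 with hG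
    have hbdd : ∀ t ∈ Set.Icc (0:ℝ) 1, G t ≤ 2 * (|β₁| + β₂ * p) + |β₁| + β₂ := by
      intro t ht
      have h1 := Lam_le_abs (2 * bT β₁ β₂ p t)
      have h2 := tangent_le β₁ β₂ hβ p hp1 t 0 ht.1 le_rfl
      rw [zero_pow (by omega)] at h2
      have h3 : |bT β₁ β₂ p t| ≤ |β₁| + β₂ * p := by
        unfold bT
        refine (abs_add_le _ _).trans ?_
        have : t ^ (p - 1) ≤ 1 := pow_le_one₀ ht.1 ht.2
        have h0 : 0 ≤ t ^ (p - 1) := pow_nonneg ht.1 _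
        rw [abs_of_nonneg (mul_nonneg hβ (mul_nonneg (Nat.cast_nonneg p) h0))]
        have : β₂ * (p * t ^ (p - 1)) ≤ β₂ * (p * 1) := by gcongr
        linarith
      rw [abs_mul, abs_two] at h1
      have : 0 ≤ β₂ * p := by positivity
      have := abs_nonneg β₁
      simp only [hG]
      linarith
    have hne : (G '' Set.Icc (0:ℝ) 1).Nonempty := ⟨G 0, 0, by simp, rfl⟩
    have hba : BddAbove (G '' Set.Icc (0:ℝ) 1) := by
      refine ⟨2 * (|β₁| + β₂ * p) + |β₁| + β₂, ?_⟩
      rintro _ ⟨t, ht, rfl⟩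
      exact hbdd t ht
    set S := sSup (G '' Set.Icc (0:ℝ) 1) with hSdef
    have hS : ∀ t ∈ Set.Icc (0:ℝ) 1, G t ≤ S := fun t ht => le_csSup hba ⟨t, ht, rfl⟩
    have hS' : ∀ c < S, ∃ t ∈ Set.Icc (0:ℝ) 1, c < G t := by
      intro c hc
      obtain ⟨_, ⟨t, ht, rfl⟩, h⟩ := exists_lt_of_lt_csSup hne hc
      exact ⟨t, ht, h⟩
    have hlim := psi_tendsto H₂ p hpE hp1 β₁ β₂ hβ S hS hS'
    have hcoe : Tendsto (fun n : ℕ => ((psiERGM H₂ β₁ β₂ n : ℝ) : EReal)) atTop (nhds (S : EReal)) :=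
      (continuous_coe_real_ereal.tendsto S).comp hlim
    have hval : sSup ((fun u : ℝ =>
          ((β₁ * u + β₂ * u ^ p : ℝ) : EReal) - ((1/2 : ℝ) : EReal) * I u) ''
            Set.Icc (0:ℝ) 1) = (S : EReal) := by
      have half : (0 : EReal) ≤ ((1/2 : ℝ) : EReal) := by
        exact_mod_cast (by norm_num : (0:ℝ) ≤ 1/2)
      apply le_antisymm
      · apply sSup_le
        rintro _ ⟨u, hu, rfl⟩
        have h1 : ((2 * bT β₁ β₂ p u * u - Lam (2 * bT β₁ β₂ p u) : ℝ) : EReal) ≤ I u := by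
          rw [hI]
          exact le_iSup (fun θ : ℝ => ((θ * u - Lam θ : ℝ) : EReal)) (2 * bT β₁ β₂ p u)
        have h2 := mul_le_mul_of_nonneg_left h1 half
        refine (EReal.sub_le_sub le_rfl h2).trans ?_
        rw [← EReal.coe_mul, ← EReal.coe_sub, EReal.coe_le_coe_iff]
        have := hS u hu
        simp only [hG, aT] at this
        linarith
      · apply le_of_forall_lt
        intro c hc
        obtain ⟨r, hcr, hrS⟩ := EReal.lt_iff_exists_real_btwn.mp hc
        obtain ⟨t, ht, hlt⟩ := hS' r (EReal.coe_lt_coe_iff.mp hrS)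
        set θ := 2 * bT β₁ β₂ p t with hθ
        have hIle : I (um θ) ≤ ((θ * um θ - Lam θ : ℝ) : EReal) := by
          rw [hI]
          apply iSup_le
          intro η
          rw [EReal.coe_le_coe_iff]
          have := Lam_tangent θ η
          linarith
        have h2 := mul_le_mul_of_nonneg_left hIle half
        have htan := tangent_le β₁ β₂ hβ p hp1 t (um θ) ht.1 (um_nonneg θ)
        refine hcr.trans (lt_of_lt_of_le ?_ (le_sSup ⟨um θ, ⟨um_nonneg θ, um_le_one θ⟩, rfl⟩))
        refine lt_of_lt_of_le ?_ (EReal.sub_le_sub le_rfl h2)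
        rw [← EReal.coe_mul, ← EReal.coe_sub, EReal.coe_lt_coe_iff]
        have : bT β₁ β₂ p t * um θ = θ * um θ / 2 := by rw [hθ]; ring
        simp only [hG] at hlt
        linarith
    rw [hval]
    exact hcoe
  · intro _ β₁ u _
    rw [hIsymm]
    congr 2
    ring
end
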